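/- Fixed-time weighted product estimate (fixed-time content of inequality (non-est-1) in Lemma 6.2): Let d be an integer with 3 ≤ d ≤ 5 and let α be a real number with 0 < α < min{2, d/2} and (4−d)/2 < α < (6−d)/2. Then there exist θ ∈ (0,1) and a constant C > 0 such that, with r̂ = d(3−θ)/(d−α−θ(2−α)) and r̂' = r̂/(r̂−1), for all Schwartz functions u, v : ℝ^d → ℂ one has ‖ |x|^{−α} conj(u) v ‖_{L^{r̂'}} ≤ C ( ‖u‖_{L²} + ‖∇u‖_{L²} )^{θ} ‖u‖_{L^{r̂}}^{1−θ} ‖v‖_{L^{r̂}}. -/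

import Mathlib

open MeasureTheory SchwartzMap

noncomputable section

/-- The `L²` norm `(∫ ‖f x‖²)^{1/2}` of a function on `ℝ^d`. -/
def L2norm {d : ℕ} (f : EuclideanSpace ℝ (Fin d) → ℂ) : ℝ :=
  (∫ x, ‖f x‖ ^ 2) ^ ((1 : ℝ) / 2)

/-- The `L²` norm `(∫ ‖∇f x‖²)^{1/2}` of the gradient of a function on `ℝ^d`. -/
def gradL2norm {d : ℕ} (f : EuclideanSpace ℝ (Fin d) → ℂ) : ℝ :=
  (∫ x, ‖fderiv ℝ f x‖ ^ 2) ^ ((1 : ℝ) / 2)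

/-- The `L^p` norm `(∫ ‖f x‖^p)^{1/p}` of a function on `ℝ^d`, for real `p`. -/
def LpNorm {d : ℕ} (p : ℝ) (f : EuclideanSpace ℝ (Fin d) → ℂ) : ℝ :=
  (∫ x, ‖f x‖ ^ p) ^ (1 / p)

open scoped ENNReal NNReal

/-- Weighted Hoelder inequality. -/
lemma aux_holder {X : Type*} [MeasurableSpace X] (μ : Measure X) {m P : ℝ} (hm : 0 < m) (hmP : m < P)
    (W f : X → ℝ≥0∞) (hW : Measurable W) (hf : Measurable f) :
    ∫⁻ x, W x * f x ^ m ∂μ ≤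
      (∫⁻ x, W x ^ (P / (P - m)) ∂μ) ^ ((P - m) / P) * ((∫⁻ x, f x ^ P ∂μ) ^ (1 / P)) ^ m := by
  have hP : 0 < P := hm.trans hmP
  have hPm : 0 < P - m := by linarith
  have hc : (P / (P - m)).HolderConjugate (P / m) := by
    rw [Real.holderConjugate_iff]
    constructor
    · rw [lt_div_iff₀ hPm]; linarith
    · field_simp; ring
  have h := ENNReal.lintegral_mul_le_Lp_mul_Lq μ hc (f := W) (g := fun x => f x ^ m)
    hW.aemeasurable (hf.pow_const m).aemeasurable
  refine h.trans (le_of_eq ?_)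
  congr 1
  · congr 1; field_simp
  · rw [← ENNReal.rpow_mul]
    congr 1
    · congr 1; ext x; rw [← ENNReal.rpow_mul]; congr 1; field_simp
    · field_simp

lemma aux_weight_ball {d : ℕ} (hd : 3 ≤ d) {κ : ℝ} (hκ : κ < d) :
    ∫⁻ x in Metric.ball (0 : EuclideanSpace ℝ (Fin d)) 1, ENNReal.ofReal (‖x‖ ^ (-κ)) < ⊤ := by
  have h : IntegrableOn (fun x : EuclideanSpace ℝ (Fin d) => ‖x‖ ^ (-κ)) (Metric.ball 0 1) := by
    refine integrableOn_ball_of_norm_le_rpow (C := 1) (α := κ) (by simp; omega) (by simpa using hκ) ?_ ?_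
    · refine Filter.Eventually.of_forall fun x => ?_
      rw [Real.norm_of_nonneg (by positivity), one_mul]
    · exact (by fun_prop : Measurable (fun x : EuclideanSpace ℝ (Fin d) => ‖x‖ ^ (-κ))).aestronglyMeasurable
  exact h.lintegral_lt_top

lemma aux_weight_compl {d : ℕ} {κ : ℝ} (hκ : (d : ℝ) < κ) :
    ∫⁻ x in (Metric.ball (0 : EuclideanSpace ℝ (Fin d)) 1)ᶜ, ENNReal.ofReal (‖x‖ ^ (-κ)) < ⊤ := by
  have h0 := integrable_one_add_norm (E := EuclideanSpace ℝ (Fin d)) (μ := volume) (r := κ)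
    (by simpa using hκ)
  have h : IntegrableOn (fun x : EuclideanSpace ℝ (Fin d) => ‖x‖ ^ (-κ)) (Metric.ball 0 1)ᶜ := by
    refine Integrable.mono' (h0.integrableOn.const_mul (2 ^ κ)) ?_ ?_
    · exact (by fun_prop : Measurable (fun x : EuclideanSpace ℝ (Fin d) => ‖x‖ ^ (-κ))).aestronglyMeasurable
    · refine (ae_restrict_iff' Metric.isOpen_ball.measurableSet.compl).2
        (Filter.Eventually.of_forall fun x hx => ?_)
      have hx1 : 1 ≤ ‖x‖ := by simpa using hx
      have hκ0 : 0 ≤ κ := (Nat.cast_nonneg d).trans hκ.le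
      rw [Real.norm_of_nonneg (by positivity), Real.rpow_neg (by positivity),
        Real.rpow_neg (by positivity), ← div_eq_mul_inv, ← one_div,
        div_le_div_iff₀ (by positivity) (by positivity), one_mul,
        ← Real.mul_rpow (by positivity) (by positivity)]
      exact Real.rpow_le_rpow (by positivity) (by linarith) hκ0
  exact h.lintegral_lt_top

/-- Local Sobolev inequality. -/
lemma aux_sobolev {d : ℕ} (hd : 3 ≤ d) : ∃ K : ℝ≥0,
    ∀ u : SchwartzMap (EuclideanSpace ℝ (Fin d)) ℂ,
      (∫⁻ x in Metric.ball (0 : EuclideanSpace ℝ (Fin d)) 1,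
        ‖u x‖ₑ ^ (2 * d / (d - 2) : ℝ)) ^ (1 / (2 * d / (d - 2) : ℝ)) ≤
      K * (eLpNorm u 2 volume + eLpNorm (fderiv ℝ u) 2 volume) := by
  let χ : ContDiffBump (0 : EuclideanSpace ℝ (Fin d)) := ⟨1, 2, by norm_num, by norm_num⟩
  have hχ1 : ContDiff ℝ 1 χ := χ.contDiff
  obtain ⟨M, hM⟩ := (χ.hasCompactSupport.fderiv (𝕜 := ℝ)).exists_bound_of_continuous
    (hχ1.continuous_fderiv one_ne_zero)
  have hM0 : 0 ≤ M := (norm_nonneg _).trans (hM 0)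
  lift M to ℝ≥0 using hM0
  have hd3 : (3 : ℝ) ≤ d := by exact_mod_cast hd
  have hPpos : 0 < (2 * d / (d - 2) : ℝ) := by
    apply div_pos <;> linarith
  set P : ℝ≥0 := ⟨(2 * d / (d - 2) : ℝ), hPpos.le⟩ with hPdef
  have hPc : (P : ℝ) = (2 * d / (d - 2) : ℝ) := rfl
  have hP0 : P ≠ 0 := by
    intro h; rw [h] at hPc; simp at hPc; rw [← hPc] at hPpos; exact lt_irrefl _ hPpos
  let S := SNormLESNormFDerivOfEqConst ℂ (volume : Measure (EuclideanSpace ℝ (Fin d))) ((2 : ℝ≥0) : ℝ)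
  refine ⟨S * (M + 1), fun u => ?_⟩
  let g : EuclideanSpace ℝ (Fin d) → ℂ := fun x => χ x • u x
  have hu1 : ContDiff ℝ 1 u := u.smooth 1
  have hg : ContDiff ℝ 1 g := hχ1.smul hu1
  have hgs : HasCompactSupport g := χ.hasCompactSupport.smul_right
  have hsob := eLpNorm_le_eLpNorm_fderiv_of_eq (volume : Measure (EuclideanSpace ℝ (Fin d)))
    (p := 2) (p' := P) hg hgs (by norm_num) (by simp; omega) (by
      rw [hPc]; simp; have : (d : ℝ) - 2 ≠ 0 := by linarith
      field_simp)
  simp only [ENNReal.coe_ofNat] at hsob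
  have h1 : (∫⁻ x in Metric.ball (0 : EuclideanSpace ℝ (Fin d)) 1, ‖u x‖ₑ ^ (P : ℝ)) ^ (1 / (P : ℝ))
      ≤ eLpNorm g P volume := by
    rw [eLpNorm_nnreal_eq_eLpNorm' hP0, eLpNorm'_eq_lintegral_enorm]
    refine ENNReal.rpow_le_rpow ?_ (by positivity)
    refine le_trans (le_of_eq ?_) (setLIntegral_le_lintegral (Metric.ball 0 1) _)
    refine setLIntegral_congr_fun Metric.isOpen_ball.measurableSet fun x hx => ?_
    have : χ x = 1 := χ.one_of_mem_closedBall (Metric.ball_subset_closedBall hx)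
    simp [g, this]
  have h2 : eLpNorm (fderiv ℝ g) 2 volume ≤
      (M + 1 : ℝ≥0) * (eLpNorm u 2 volume + eLpNorm (fderiv ℝ u) 2 volume) := by
    have hfd : ∀ x, ‖fderiv ℝ g x‖ ≤ M * ‖u x‖ + ‖fderiv ℝ u x‖ := fun x => by
      have hA : fderiv ℝ g x = χ x • fderiv ℝ u x + (fderiv ℝ χ x).smulRight (u x) :=
        fderiv_fun_smul (hχ1.differentiable one_ne_zero x) (hu1.differentiable one_ne_zero x)
      rw [hA]
      refine (norm_add_le _ _).trans ?_
      rw [norm_smul, ContinuousLinearMap.norm_smulRight_apply, Real.norm_of_nonneg χ.nonneg, add_comm]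
      gcongr
      · exact hM x
      · exact mul_le_of_le_one_left (norm_nonneg _) χ.le_one
    have hmu : AEStronglyMeasurable (fun x => (M : ℝ) • ‖u x‖) (volume : Measure (EuclideanSpace ℝ (Fin d))) :=
      (u.continuous.norm.const_smul (M : ℝ)).aestronglyMeasurable
    have hmf : AEStronglyMeasurable (fun x => ‖fderiv ℝ u x‖) (volume : Measure (EuclideanSpace ℝ (Fin d))) :=
      (hu1.continuous_fderiv one_ne_zero).norm.aestronglyMeasurable
    calc eLpNorm (fderiv ℝ g) 2 volume
        ≤ eLpNorm ((fun x => (M : ℝ) • ‖u x‖) + (fun x => ‖fderiv ℝ u x‖)) 2 volume :=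
          eLpNorm_mono_real hfd
      _ ≤ eLpNorm (fun x => (M : ℝ) • ‖u x‖) 2 volume + eLpNorm (fun x => ‖fderiv ℝ u x‖) 2 volume :=
          eLpNorm_add_le hmu hmf (by norm_num)
      _ = (M : ℝ≥0∞) * eLpNorm u 2 volume + eLpNorm (fderiv ℝ u) 2 volume := by
          rw [eLpNorm_norm]
          congr 1
          have := eLpNorm_const_smul (p := 2) (M : ℝ) (fun x => ‖u x‖) (volume : Measure (EuclideanSpace ℝ (Fin d)))
          rw [eLpNorm_norm] at this
          refine this.trans ?_
          congr 1
          rw [Real.enorm_eq_ofReal (NNReal.coe_nonneg M), ENNReal.ofReal_coe_nnreal]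
      _ ≤ _ := by
          push_cast
          rw [mul_add]
          gcongr
          · exact le_self_add
          · conv_lhs => rw [← one_mul (eLpNorm (fderiv ℝ u) 2 volume)]
            gcongr
            exact le_add_self
  calc _ ≤ eLpNorm g P volume := h1
    _ ≤ _ := hsob
    _ ≤ S * ((M + 1 : ℝ≥0) * (eLpNorm u 2 volume + eLpNorm (fderiv ℝ u) 2 volume)) := by
        gcongr
    _ = _ := by rw [← mul_assoc]; push_cast; rfl

lemma aux_weighted {d : ℕ} (hd : 3 ≤ d) {γ m : ℝ} (hm : 0 < m) (hm2 : m < 2)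
    (h1 : m * (d - 2) / 2 < d - γ) (h2 : d - γ < d * m / 2) : ∃ K : ℝ≥0,
    ∀ u : SchwartzMap (EuclideanSpace ℝ (Fin d)) ℂ,
      ∫⁻ x, ENNReal.ofReal (‖x‖ ^ (-γ)) * ‖u x‖ₑ ^ m ≤
      K * (eLpNorm u 2 volume + eLpNorm (fderiv ℝ u) 2 volume) ^ m := by
  obtain ⟨K, hK⟩ := aux_sobolev hd
  have hd3 : (3 : ℝ) ≤ d := by exact_mod_cast hd
  have hd2 : (0 : ℝ) < d - 2 := by linarith
  set P : ℝ := 2 * d / (d - 2) with hP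
  have hP2 : 2 < P := by rw [hP, lt_div_iff₀ hd2]; linarith
  have hmP : m < P := hm2.trans hP2
  have hW : ∀ ρ : ℝ, 0 ≤ ρ → ∀ x : EuclideanSpace ℝ (Fin d),
      ENNReal.ofReal (‖x‖ ^ (-γ)) ^ ρ = ENNReal.ofReal (‖x‖ ^ (-(γ * ρ))) := fun ρ hρ x => by
    rw [ENNReal.ofReal_rpow_of_nonneg (by positivity) hρ, ← Real.rpow_mul (norm_nonneg _)]
    ring_nf
  have hPm : 0 < P - m := by linarith
  have hI1 : ∫⁻ x in Metric.ball (0 : EuclideanSpace ℝ (Fin d)) 1,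
      ENNReal.ofReal (‖x‖ ^ (-γ)) ^ (P / (P - m)) < ⊤ := by
    simp_rw [hW (P / (P - m)) (by positivity)]
    apply aux_weight_ball hd
    rw [mul_div_assoc', div_lt_iff₀ hPm]
    have hPd : P * (d - 2) = 2 * d := by rw [hP]; field_simp
    nlinarith [mul_lt_mul_of_pos_right h1 (by linarith : 0 < P)]
  have hI2 : ∫⁻ x in (Metric.ball (0 : EuclideanSpace ℝ (Fin d)) 1)ᶜ,
      ENNReal.ofReal (‖x‖ ^ (-γ)) ^ (2 / (2 - m)) < ⊤ := by
    have h2m : 0 < 2 - m := by linarith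
    simp_rw [hW (2 / (2 - m)) (by positivity)]
    apply aux_weight_compl
    rw [mul_div_assoc', lt_div_iff₀ h2m]
    nlinarith
  have hA1 : (∫⁻ x in Metric.ball (0 : EuclideanSpace ℝ (Fin d)) 1,
      ENNReal.ofReal (‖x‖ ^ (-γ)) ^ (P / (P - m))) ^ ((P - m) / P) ≠ ⊤ :=
    ENNReal.rpow_ne_top_of_nonneg (by positivity) hI1.ne
  have hA2 : (∫⁻ x in (Metric.ball (0 : EuclideanSpace ℝ (Fin d)) 1)ᶜ,
      ENNReal.ofReal (‖x‖ ^ (-γ)) ^ (2 / (2 - m))) ^ ((2 - m) / 2) ≠ ⊤ :=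
    ENNReal.rpow_ne_top_of_nonneg (by apply div_nonneg <;> linarith) hI2.ne
  lift (∫⁻ x in Metric.ball (0 : EuclideanSpace ℝ (Fin d)) 1,
      ENNReal.ofReal (‖x‖ ^ (-γ)) ^ (P / (P - m))) ^ ((P - m) / P) to ℝ≥0 using hA1 with A1 hB1
  lift (∫⁻ x in (Metric.ball (0 : EuclideanSpace ℝ (Fin d)) 1)ᶜ,
      ENNReal.ofReal (‖x‖ ^ (-γ)) ^ (2 / (2 - m))) ^ ((2 - m) / 2) to ℝ≥0 using hA2 with A2 hB2
  refine ⟨A1 * K ^ m + A2, fun u => ?_⟩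
  have hmw : Measurable fun x : EuclideanSpace ℝ (Fin d) => ENNReal.ofReal (‖x‖ ^ (-γ)) := by fun_prop
  have hmu : Measurable fun x : EuclideanSpace ℝ (Fin d) => ‖u x‖ₑ := u.continuous.measurable.enorm
  rw [← lintegral_add_compl _ (Metric.isOpen_ball (x := (0 : EuclideanSpace ℝ (Fin d))) (ε := 1)).measurableSet]
  have e1 := aux_holder (volume.restrict (Metric.ball (0 : EuclideanSpace ℝ (Fin d)) 1)) hm hmP _ _ hmw hmu
  have e2 := aux_holder (volume.restrict (Metric.ball (0 : EuclideanSpace ℝ (Fin d)) 1)ᶜ) hm hm2 _ _ hmw hmu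
  rw [← hB1] at e1
  rw [← hB2] at e2
  have f2 : (∫⁻ x in (Metric.ball (0 : EuclideanSpace ℝ (Fin d)) 1)ᶜ, ‖u x‖ₑ ^ (2 : ℝ)) ^ (1 / (2 : ℝ))
      ≤ eLpNorm u 2 volume + eLpNorm (fderiv ℝ u) 2 volume := by
    refine le_trans ?_ le_self_add
    rw [eLpNorm_eq_eLpNorm' (by norm_num) (by norm_num), eLpNorm'_eq_lintegral_enorm]
    simp only [ENNReal.toReal_ofNat]
    exact ENNReal.rpow_le_rpow (setLIntegral_le_lintegral _ _) (by norm_num)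
  refine (add_le_add (e1.trans (mul_le_mul_right (ENNReal.rpow_le_rpow (hK u) hm.le) _))
    (e2.trans (mul_le_mul_right (ENNReal.rpow_le_rpow f2 hm.le) _))).trans (le_of_eq ?_)
  rw [ENNReal.mul_rpow_of_nonneg _ _ hm.le, ← mul_assoc, ← add_mul]
  congr 1
  push_cast
  rw [ENNReal.coe_rpow_of_nonneg _ hm.le]

lemma aux_toReal {d : ℕ} {F : Type*} [NormedAddCommGroup F] {p : ℝ} (hp : 0 < p)
    {f : EuclideanSpace ℝ (Fin d) → F} (hf : AEStronglyMeasurable f volume) :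
    (∫ x, ‖f x‖ ^ p) ^ (1 / p) = ((∫⁻ x, ‖f x‖ₑ ^ p) ^ (1 / p)).toReal := by
  rw [← ENNReal.toReal_rpow, integral_eq_lintegral_of_nonneg_ae]
  · congr 3
    ext x
    rw [← ofReal_norm, ENNReal.ofReal_rpow_of_nonneg (norm_nonneg _) hp.le]
  · exact Filter.Eventually.of_forall fun x => by positivity
  · exact (hf.norm.aemeasurable.pow_const p).aestronglyMeasurable

lemma aux_toReal_two {d : ℕ} {F : Type*} [NormedAddCommGroup F]
    {f : EuclideanSpace ℝ (Fin d) → F} (hf : AEStronglyMeasurable f volume) :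
    (∫ x, ‖f x‖ ^ 2) ^ ((1 : ℝ) / 2) = (eLpNorm f 2 volume).toReal := by
  rw [eLpNorm_eq_eLpNorm' (by norm_num) (by norm_num), eLpNorm'_eq_lintegral_enorm,
    ENNReal.toReal_ofNat, ← aux_toReal (by norm_num) hf]
  norm_num

lemma aux_product {X : Type*} [MeasurableSpace X] (μ : Measure X) {θ q r : ℝ} (hθ0 : 0 < θ)
    (hθ1 : θ < 1) (hq : 0 < q) (hr : 2 < r) (hrel : 1 - 2 / r = (1 - θ) / r + 1 / q)
    (w a b : X → ℝ≥0∞) (hw : Measurable w) (ha : Measurable a) (hb : Measurable b) :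
    (∫⁻ x, (w x * a x * b x) ^ (r / (r - 1)) ∂μ) ^ (1 / (r / (r - 1))) ≤
      (∫⁻ x, w x ^ q * a x ^ (θ * q) ∂μ) ^ (1 / q) *
        ((∫⁻ x, a x ^ r ∂μ) ^ (1 / r)) ^ (1 - θ) * (∫⁻ x, b x ^ r ∂μ) ^ (1 / r) := by
  have hr0 : 0 < r := by linarith
  have hr1 : 0 < r - 1 := by linarith
  have hr2 : 0 < r - 2 := by linarith
  have hθ : 0 < 1 - θ := by linarith
  have h1 := ENNReal.lintegral_Lp_mul_le_Lq_mul_Lr (p := r / (r - 1)) (q := r / (r - 2)) (r := r)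
    (by positivity) (by apply div_lt_div_of_pos_left <;> linarith) (by field_simp; ring) μ
    (f := fun x => w x * a x) (g := b) (hw.mul ha).aemeasurable hb.aemeasurable
  refine h1.trans ?_
  gcongr
  have hs : 1 / (r / (r - 2)) = 1 / q + 1 / (r / (1 - θ)) := by
    have e1 : 1 / (r / (r - 2)) = 1 - 2 / r := by field_simp
    have e2 : 1 / (r / (1 - θ)) = (1 - θ) / r := by field_simp
    rw [e1, e2, hrel, add_comm]
  have hlt : r / (r - 2) < q := by
    have : 1 / q < 1 / (r / (r - 2)) := by rw [hs]; linarith [show 0 < 1 / (r / (1 - θ)) by positivity]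
    exact lt_of_one_div_lt_one_div hq this
  have h2 := ENNReal.lintegral_Lp_mul_le_Lq_mul_Lr (p := r / (r - 2)) (q := q) (r := r / (1 - θ))
    (by positivity) hlt hs μ
    (f := fun x => w x * a x ^ θ) (g := fun x => a x ^ (1 - θ)) (hw.mul (ha.pow_const _)).aemeasurable
    (ha.pow_const _).aemeasurable
  refine le_trans (le_of_eq ?_) (h2.trans (le_of_eq ?_))
  · congr 2
    ext x
    simp only [Pi.mul_apply]
    rw [mul_assoc, ← ENNReal.rpow_add_of_nonneg _ _ hθ0.le hθ.le]
    simp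
  · congr 1
    · congr 2
      ext x
      rw [ENNReal.mul_rpow_of_nonneg _ _ hq.le, ← ENNReal.rpow_mul]
    · rw [← ENNReal.rpow_mul]
      congr 1
      · congr 1; ext x; rw [← ENNReal.rpow_mul]; congr 1; field_simp
      · field_simp

/-- Fixed-time weighted product estimate
(fixed-time content of inequality (non-est-1) in Lemma 6.2). -/
theorem fixed_time_weighted_product_estimate
    (d : ℕ) (hd3 : 3 ≤ d) (hd5 : d ≤ 5) (α : ℝ)
    (hα0 : 0 < α) (hα1 : α < min 2 ((d : ℝ) / 2))
    (hαl : (4 - (d : ℝ)) / 2 < α) (hαu : α < (6 - (d : ℝ)) / 2) :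
    ∃ θ : ℝ, 0 < θ ∧ θ < 1 ∧ ∃ C > 0,
      ∀ rhat : ℝ, rhat = (d : ℝ) * (3 - θ) / ((d : ℝ) - α - θ * (2 - α)) →
        ∀ u v : SchwartzMap (EuclideanSpace ℝ (Fin d)) ℂ,
          LpNorm (rhat / (rhat - 1))
              (fun x => Complex.ofReal (‖x‖ ^ (-α)) * (starRingEnd ℂ) (u x) * v x) ≤
            C * (L2norm (⇑u) + gradL2norm (⇑u)) ^ θ
              * (LpNorm rhat (⇑u)) ^ (1 - θ) * LpNorm rhat (⇑v) := by
  have hd : (3 : ℝ) ≤ d := by exact_mod_cast hd3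
  have hα2 : α < 2 := hα1.trans_le (min_le_left _ _)
  have hαd : α < (d : ℝ) / 2 := hα1.trans_le (min_le_right _ _)
  have hdpos : (0 : ℝ) < d := by linarith
  obtain ⟨θ, hθ⟩ : ∃ θ : ℝ, θ = α / d := ⟨_, rfl⟩
  have hθd : θ * d = α := by rw [hθ]; field_simp
  have hθ0 : 0 < θ := by rw [hθ]; positivity
  have hθ1 : θ < 1 / 2 := by rw [hθ, div_lt_iff₀ hdpos]; linarith
  have hB : 0 < α + θ * (2 - α) := by
    have := mul_pos hθ0 (by linarith : 0 < 2 - α); linarith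
  obtain ⟨q, hqdef⟩ : ∃ q : ℝ, q = d / (α + θ * (2 - α)) := ⟨_, rfl⟩
  have hq : 0 < q := by rw [hqdef]; positivity
  have hqB : q * (α + θ * (2 - α)) = d := by rw [hqdef]; field_simp
  have hm : 0 < θ * q := mul_pos hθ0 hq
  have hdg : (d : ℝ) - α * q = θ * q * (2 - α) := by linarith
  obtain ⟨K, hK⟩ := aux_weighted hd3 (γ := α * q) (m := θ * q) hm
    (by rw [hqdef, mul_div_assoc', div_lt_iff₀ hB]; nlinarith)
    (by rw [hdg]; nlinarith)
    (by rw [hdg]; nlinarith)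
  refine ⟨θ, hθ0, by linarith, ((K : ℝ≥0∞) ^ (1 / q)).toReal + 1, by positivity, ?_⟩
  intro r hr u v
  have hD : 0 < (d : ℝ) - α - θ * (2 - α) := by nlinarith
  have hr2 : 2 < r := by
    rw [hr, lt_div_iff₀ hD]; nlinarith
  have hr0 : 0 < r := by linarith
  have hr1 : 0 < r - 1 := by linarith
  have hrel : 1 - 2 / r = (1 - θ) / r + 1 / q := by
    have hrD : r * ((d : ℝ) - α - θ * (2 - α)) = d * (3 - θ) := by rw [hr]; field_simp
    have h1q : 1 / q = (α + θ * (2 - α)) / d := by rw [hqdef]; field_simp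
    rw [h1q]; field_simp; linarith
  have hmw : Measurable fun x : EuclideanSpace ℝ (Fin d) => ENNReal.ofReal (‖x‖ ^ (-α)) := by fun_prop
  have hmu : Measurable fun x : EuclideanSpace ℝ (Fin d) => ‖u x‖ₑ := u.continuous.measurable.enorm
  have hmv : Measurable fun x : EuclideanSpace ℝ (Fin d) => ‖v x‖ₑ := v.continuous.measurable.enorm
  have hprod := aux_product volume hθ0 (by linarith) hq hr2 hrel _ _ _ hmw hmu hmv
  have hfin : ∀ w : SchwartzMap (EuclideanSpace ℝ (Fin d)) ℂ,
      (∫⁻ x, ‖w x‖ₑ ^ r) ^ (1 / r) ≠ ⊤ := fun w => by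
    have := (w.memLp (ENNReal.ofReal r) volume).2.ne
    rwa [eLpNorm_eq_eLpNorm' (by simpa using hr0) (by simp), eLpNorm'_eq_lintegral_enorm,
      ENNReal.toReal_ofReal hr0.le] at this
  have hu2 : eLpNorm u 2 volume ≠ ⊤ := (u.memLp 2 volume).2.ne
  have hdu2 : eLpNorm (fderiv ℝ u) 2 volume ≠ ⊤ :=
    ((SchwartzMap.fderivCLM ℝ (EuclideanSpace ℝ (Fin d)) ℂ u).memLp 2 volume).2.ne
  have hweq : ∀ x : EuclideanSpace ℝ (Fin d),
      ENNReal.ofReal (‖x‖ ^ (-α)) ^ q = ENNReal.ofReal (‖x‖ ^ (-(α * q))) := fun x => by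
    rw [ENNReal.ofReal_rpow_of_nonneg (by positivity) hq.le, ← Real.rpow_mul (norm_nonneg _)]
    ring_nf
  simp_rw [hweq] at hprod
  have hK' : (∫⁻ x, ENNReal.ofReal (‖x‖ ^ (-(α * q))) * ‖u x‖ₑ ^ (θ * q)) ^ (1 / q) ≤
      (K : ℝ≥0∞) ^ (1 / q) * (eLpNorm u 2 volume + eLpNorm (fderiv ℝ u) 2 volume) ^ θ := by
    refine (ENNReal.rpow_le_rpow (hK u) (by positivity)).trans (le_of_eq ?_)
    rw [ENNReal.mul_rpow_of_nonneg _ _ (by positivity), ← ENNReal.rpow_mul]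
    congr 2
    field_simp
  have hmeas : AEStronglyMeasurable (fun x : EuclideanSpace ℝ (Fin d) =>
      Complex.ofReal (‖x‖ ^ (-α)) * (starRingEnd ℂ) (u x) * v x) volume := by
    refine AEStronglyMeasurable.mul (AEStronglyMeasurable.mul ?_ ?_) v.continuous.aestronglyMeasurable
    · exact (Complex.measurable_ofReal.comp (by fun_prop)).aestronglyMeasurable
    · exact (Complex.continuous_conj.comp u.continuous).aestronglyMeasurable
  have hLHS : LpNorm (r / (r - 1))
      (fun x => Complex.ofReal (‖x‖ ^ (-α)) * (starRingEnd ℂ) (u x) * v x) =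
      ((∫⁻ x, (ENNReal.ofReal (‖x‖ ^ (-α)) * ‖u x‖ₑ * ‖v x‖ₑ) ^ (r / (r - 1))) ^
        (1 / (r / (r - 1)))).toReal := by
    rw [LpNorm, aux_toReal (by positivity) hmeas]
    congr 3
    ext x
    congr 1
    rw [enorm_mul, enorm_mul]
    congr 2
    · rw [← ofReal_norm, Complex.norm_real, Real.norm_of_nonneg (by positivity)]
    · rw [← ofReal_norm, RCLike.norm_conj, ofReal_norm]
  have hmdu : AEStronglyMeasurable (fderiv ℝ u) (volume : Measure (EuclideanSpace ℝ (Fin d))) :=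
    ((u.smooth 1).continuous_fderiv one_ne_zero).aestronglyMeasurable
  rw [hLHS, LpNorm, LpNorm, aux_toReal hr0 u.continuous.aestronglyMeasurable,
    aux_toReal hr0 v.continuous.aestronglyMeasurable, L2norm, gradL2norm,
    aux_toReal_two u.continuous.aestronglyMeasurable, aux_toReal_two hmdu,
    ← ENNReal.toReal_add hu2 hdu2]
  have hKt : (K : ℝ≥0∞) ^ (1 / q) ≠ ⊤ := ENNReal.rpow_ne_top_of_nonneg (by positivity) ENNReal.coe_ne_top
  have hHt : (eLpNorm u 2 volume + eLpNorm (fderiv ℝ u) 2 volume) ^ θ ≠ ⊤ :=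
    ENNReal.rpow_ne_top_of_nonneg hθ0.le (ENNReal.add_ne_top.2 ⟨hu2, hdu2⟩)
  have hUt : ((∫⁻ x, ‖u x‖ₑ ^ r) ^ (1 / r)) ^ (1 - θ) ≠ ⊤ :=
    ENNReal.rpow_ne_top_of_nonneg (by linarith) (hfin u)
  have hfinal := ENNReal.toReal_mono
    (ENNReal.mul_ne_top (ENNReal.mul_ne_top (ENNReal.mul_ne_top hKt hHt) hUt) (hfin v))
    (hprod.trans (mul_le_mul_left (mul_le_mul_left hK' _) _))
  refine hfinal.trans ?_
  rw [ENNReal.toReal_mul, ENNReal.toReal_mul, ENNReal.toReal_mul,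
    ← ENNReal.toReal_rpow _ θ, ← ENNReal.toReal_rpow _ (1 - θ)]
  gcongr
  linarith

end
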